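/- (Lemma 3.1(a)) Assume (h1), (h2), (h3) and let f satisfy (f1)–(f4). For each u ∈ X which is not a.e. zero, there exists a unique t_u > 0 such that t_u u ∈ N; moreover the function g(t) = t‖u‖² − ∫_{ℝ^N} K(x) f(t u(x)) u(x) dx satisfies g(t) > 0 for all t ∈ (0, t_u), g(t_u) = 0, and g(t) < 0 for all t ∈ (t_u, ∞), and J(t_u u) = max_{t ≥ 0} J(t u). -/

import Mathlib

open MeasureTheory Filter

noncomputable section

namespace ZeroMass

/-- The ambient Euclidean space `ℝ^N`. -/
abbrev EN (N : ℕ) := EuclideanSpace ℝ (Fin N)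

/-- The critical fractional Sobolev exponent `2*_α = 2N/(N-2α)`. -/
def critExp (N : ℕ) (α : ℝ) : ℝ := 2 * N / (N - 2 * α)

/-- The square of the Gagliardo seminorm `[u]²`. -/
def gagSq (N : ℕ) (α : ℝ) (u : EN N → ℝ) : ENNReal :=
  ∫⁻ p : EN N × EN N, ENNReal.ofReal ((u p.1 - u p.2) ^ 2 / ‖p.1 - p.2‖ ^ ((N : ℝ) + 2 * α))

/-- The square of the full norm `‖u‖² = [u]² + ∫ V u²`. -/
def normSq {N : ℕ} (α : ℝ) (V : EN N → ℝ) (u : EN N → ℝ) : ENNReal :=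
  gagSq N α u + ∫⁻ x, ENNReal.ofReal (V x * u x ^ 2)

/-- Membership in the space `X`. -/
def memX {N : ℕ} (α : ℝ) (V : EN N → ℝ) (u : EN N → ℝ) : Prop :=
  Measurable u ∧ normSq α V u < ⊤

/-- The norm of `X`, i.e. `‖u‖ = ([u]² + ∫ V u²)^{1/2}`. -/
def Xnorm {N : ℕ} (α : ℝ) (V : EN N → ℝ) (u : EN N → ℝ) : ℝ :=
  ((normSq α V u).toReal) ^ (1 / 2 : ℝ)

/-- The primitive `F(t) = ∫₀ᵗ f(τ) dτ`. -/
def prim (f : ℝ → ℝ) (t : ℝ) : ℝ := ∫ τ in (0 : ℝ)..t, f τ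

/-- The energy functional `J`. -/
def Jfun {N : ℕ} (α : ℝ) (V K : EN N → ℝ) (f : ℝ → ℝ) (u : EN N → ℝ) : ℝ :=
  (1 / 2) * (normSq α V u).toReal - ∫ x, K x * prim f (u x)

/-- The pairing `⟨J'(u), φ⟩`. -/
def Jd {N : ℕ} (α : ℝ) (V K : EN N → ℝ) (f : ℝ → ℝ) (u φ : EN N → ℝ) : ℝ :=
  (∫ p : EN N × EN N, (u p.1 - u p.2) * (φ p.1 - φ p.2) / ‖p.1 - p.2‖ ^ ((N : ℝ) + 2 * α))
    + (∫ x, V x * u x * φ x) - ∫ x, K x * f (u x) * φ x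

/-- Positive part `u⁺ = max(u, 0)`. -/
def uplus {N : ℕ} (u : EN N → ℝ) : EN N → ℝ := fun x => max (u x) 0

/-- Negative part `u⁻ = min(u, 0)`. -/
def uminus {N : ℕ} (u : EN N → ℝ) : EN N → ℝ := fun x => min (u x) 0

/-- `u` is not almost everywhere zero. -/
def NotAEZero {N : ℕ} (u : EN N → ℝ) : Prop :=
  ¬ (u =ᵐ[(volume : Measure (EN N))] (0 : EN N → ℝ))

/-- Hypothesis (h1): `V, K > 0` everywhere and `K` bounded. -/
def H1 {N : ℕ} (V K : EN N → ℝ) : Prop :=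
  (∀ x, 0 < V x) ∧ (∀ x, 0 < K x) ∧ ∃ C : ℝ, ∀ x, K x ≤ C

/-- Hypothesis (h2): uniform vanishing of `∫_{A_n ∩ {|x| ≥ r}} K`. -/
def H2 {N : ℕ} (K : EN N → ℝ) : Prop :=
  ∀ (A : ℕ → Set (EN N)) (R : ℝ), 0 < R → (∀ n, MeasurableSet (A n)) →
    (∀ n, volume (A n) ≤ ENNReal.ofReal R) →
    ∀ ε : ℝ, 0 < ε → ∃ r₀ : ℝ, ∀ r : ℝ, r₀ ≤ r → ∀ n,
      (∫⁻ x in A n ∩ {x : EN N | r ≤ ‖x‖}, ENNReal.ofReal (K x)) ≤ ENNReal.ofReal ε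

/-- Hypothesis (h3): `K/V` is bounded. -/
def H3 {N : ℕ} (V K : EN N → ℝ) : Prop := ∃ C : ℝ, ∀ x, K x / V x ≤ C

/-- Hypothesis (h4) with exponent `m`. -/
def H4 {N : ℕ} (α : ℝ) (V K : EN N → ℝ) (m : ℝ) : Prop :=
  2 < m ∧ m < critExp N α ∧
    Tendsto (fun x : EN N => K x / V x ^ ((critExp N α - m) / (critExp N α - 2)))
      (comap (fun x : EN N => ‖x‖) atTop) (nhds 0)

/-- Hypothesis (f1): `f(t)/|t| → 0` as `t → 0`. -/
def Cf1 (f : ℝ → ℝ) : Prop :=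
  Tendsto (fun t : ℝ => f t / |t|) (nhdsWithin 0 {(0 : ℝ)}ᶜ) (nhds 0)

/-- Hypothesis (f̃1): `limsup_{t→0} f(t)/|t|^{m-1} < ∞`. -/
def Cf1' (f : ℝ → ℝ) (m : ℝ) : Prop :=
  ∃ C : ℝ, ∀ᶠ t in nhdsWithin (0 : ℝ) {(0 : ℝ)}ᶜ, f t / |t| ^ (m - 1) ≤ C

/-- Hypothesis (f2) with exponent `p`: `f(t)/|t|^{p-1} → 0` as `|t| → ∞`. -/
def Cf2 (f : ℝ → ℝ) (p : ℝ) : Prop :=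
  Tendsto (fun t : ℝ => f t / |t| ^ (p - 1)) (comap (fun t : ℝ => |t|) atTop) (nhds 0)

/-- Hypothesis (f3): `F(t)/t² → +∞` as `|t| → ∞`. -/
def Cf3 (f : ℝ → ℝ) : Prop :=
  Tendsto (fun t : ℝ => prim f t / t ^ 2) (comap (fun t : ℝ => |t|) atTop) atTop

/-- Hypothesis (f4): `t ↦ f(t)/|t|` is strictly increasing on `ℝ \ {0}`. -/
def Cf4 (f : ℝ → ℝ) : Prop :=
  ∀ s t : ℝ, s ≠ 0 → t ≠ 0 → s < t → f s / |s| < f t / |t|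

/-- Nehari manifold membership, formulated with the pairing `⟨J'(u), u⟩ = 0`. -/
def memNehari {N : ℕ} (α : ℝ) (V K : EN N → ℝ) (f : ℝ → ℝ) (u : EN N → ℝ) : Prop :=
  memX α V u ∧ NotAEZero u ∧ Jd α V K f u u = 0

/-- Nehari manifold membership, formulated as `‖u‖² = ∫ K f(u) u`. -/
def memNehari2 {N : ℕ} (α : ℝ) (V K : EN N → ℝ) (f : ℝ → ℝ) (u : EN N → ℝ) : Prop :=
  memX α V u ∧ NotAEZero u ∧ (normSq α V u).toReal = ∫ x, K x * f (u x) * u x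

/-- Nodal (sign-changing) Nehari set membership. -/
def memM {N : ℕ} (α : ℝ) (V K : EN N → ℝ) (f : ℝ → ℝ) (u : EN N → ℝ) : Prop :=
  memNehari α V K f u ∧ NotAEZero (uplus u) ∧ NotAEZero (uminus u) ∧
    Jd α V K f u (uplus u) = 0 ∧ Jd α V K f u (uminus u) = 0

/-- Weak convergence in `X` of the sequence `u` to `w`. -/
def weakConv {N : ℕ} (α : ℝ) (V : EN N → ℝ) (u : ℕ → EN N → ℝ) (w : EN N → ℝ) : Prop :=
  ∀ v : EN N → ℝ, memX α V v →
    Tendsto (fun n =>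
      (∫ p : EN N × EN N,
        ((u n p.1 - w p.1) - (u n p.2 - w p.2)) * (v p.1 - v p.2)
          / ‖p.1 - p.2‖ ^ ((N : ℝ) + 2 * α))
      + ∫ x, V x * (u n x - w x) * v x) atTop (nhds 0)

end ZeroMass

open ZeroMass

namespace ZeroMass

/-- The Gagliardo kernel `|u(x) - u(y)|² / |x - y|^{N+2α}`. -/
def gagKernel {N : ℕ} (α : ℝ) (u : EN N → ℝ) (x y : EN N) : ℝ :=
  (u x - u y) ^ 2 / ‖x - y‖ ^ ((N : ℝ) + 2 * α)

/-- The density `D(x) = ∫ |u(x) - u(y)|² / |x - y|^{N+2α} dy` of the squared seminorm. -/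
def gagDensity {N : ℕ} (α : ℝ) (u : EN N → ℝ) (x : EN N) : ENNReal :=
  ∫⁻ y, ENNReal.ofReal (gagKernel α u x y)

/-- The mean of `u` over the ball of center `x` and radius `r`. -/
def ballMean {N : ℕ} (u : EN N → ℝ) (x : EN N) (r : ℝ) : ℝ :=
  ⨍ y in Metric.ball x r, u y

/-- The volume of the unit ball. -/
def unitVol (N : ℕ) : ℝ := volume.real (Metric.ball (0 : EN N) 1)

lemma unitVol_pos (N : ℕ) : 0 < unitVol N :=
  ENNReal.toReal_pos (Metric.measure_ball_pos _ _ one_pos).ne' measure_ball_lt_top.ne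

lemma volume_ball_eq {N : ℕ} (x : EN N) {r : ℝ} (hr : 0 < r) :
    volume (Metric.ball x r) = ENNReal.ofReal (r ^ N * unitVol N) := by
  rw [Measure.addHaar_ball_of_pos _ _ hr, ENNReal.ofReal_mul (by positivity), unitVol,
    measureReal_def, ENNReal.ofReal_toReal measure_ball_lt_top.ne, finrank_euclideanSpace,
    Fintype.card_fin]

lemma measurable_gagKernel {N : ℕ} (α : ℝ) {u : EN N → ℝ} (hu : Measurable u) :
    Measurable (fun p : EN N × EN N => gagKernel α u p.1 p.2) := by
  unfold gagKernel
  have h1 : Measurable (fun p : EN N × EN N => u p.1) := hu.comp measurable_fst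
  have h2 : Measurable (fun p : EN N × EN N => u p.2) := hu.comp measurable_snd
  have h3 : Measurable (fun p : EN N × EN N => ‖p.1 - p.2‖) := by fun_prop
  exact ((h1.sub h2).pow_const 2).div (h3.pow_const _)

lemma measurable_gagDensity {N : ℕ} (α : ℝ) {u : EN N → ℝ} (hu : Measurable u) :
    Measurable (gagDensity α u) :=
  (measurable_gagKernel α hu).ennreal_ofReal.lintegral_prod_right'

lemma lintegral_gagDensity {N : ℕ} (α : ℝ) {u : EN N → ℝ} (hu : Measurable u) :
    ∫⁻ x, gagDensity α u x = gagSq N α u := by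
  unfold gagSq gagDensity
  rw [Measure.volume_eq_prod, lintegral_prod]
  · rfl
  · exact (measurable_gagKernel α hu).ennreal_ofReal.aemeasurable

lemma sq_sub_le_gagKernel {N : ℕ} {α : ℝ} (hα : 0 ≤ α) (u : EN N → ℝ) {x y : EN N} {R : ℝ}
    (h : ‖x - y‖ ≤ R) :
    (u x - u y) ^ 2 ≤ R ^ ((N : ℝ) + 2 * α) * gagKernel α u x y := by
  unfold gagKernel
  rcases eq_or_ne x y with rfl | hxy
  · simp
  have h0 : 0 < ‖x - y‖ := norm_pos_iff.2 (sub_ne_zero.2 hxy)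
  rw [mul_div_assoc', le_div_iff₀ (by positivity), mul_comm]
  gcongr

lemma setLIntegral_sq_sub_le {N : ℕ} {α : ℝ} (hα : 0 ≤ α) (u : EN N → ℝ) (x z : EN N) {r R : ℝ}
    (h : ‖z - x‖ + r ≤ R) :
    ∫⁻ y in Metric.ball x r, ENNReal.ofReal ((u z - u y) ^ 2) ≤
      ENNReal.ofReal (R ^ ((N : ℝ) + 2 * α)) * gagDensity α u z := by
  unfold gagDensity
  rw [← lintegral_const_mul' _ _ ENNReal.ofReal_ne_top]
  refine le_trans ?_ (setLIntegral_le_lintegral (Metric.ball x r) _)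
  refine setLIntegral_mono' measurableSet_ball fun y hy => ?_
  rw [Metric.mem_ball, dist_eq_norm] at hy
  have hzy : ‖z - y‖ ≤ R := by
    have : z - y = (z - x) - (y - x) := by abel
    rw [this]
    exact (norm_sub_le _ _).trans (by linarith)
  have hR : 0 ≤ R := (norm_nonneg _).trans hzy
  rw [← ENNReal.ofReal_mul (by positivity)]
  exact ENNReal.ofReal_le_ofReal (sq_sub_le_gagKernel hα u hzy)

/-- Jensen's inequality for the square, tested against an arbitrary constant. -/
lemma ofReal_sq_sub_average_mul_le {Ω : Type*} [MeasurableSpace Ω] (ν : Measure Ω)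
    [IsFiniteMeasure ν] {w : Ω → ℝ} (hw : Integrable w ν) (m : ℝ) :
    ENNReal.ofReal ((m - ⨍ y, w y ∂ν) ^ 2) * ν Set.univ ≤
      ∫⁻ y, ENNReal.ofReal ((m - w y) ^ 2) ∂ν := by
  by_cases hi : Integrable (fun y => (m - w y) ^ 2) ν
  · rw [← ofReal_integral_eq_lintegral_ofReal hi (ae_of_all _ fun y => sq_nonneg _),
      ← ofReal_measureReal, ← ENNReal.ofReal_mul (sq_nonneg _)]
    apply ENNReal.ofReal_le_ofReal
    set a := ⨍ y, w y ∂ν with ha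
    have hint : ∫ y, w y ∂ν = ν.real Set.univ * a := by
      rw [ha, average_eq]
      by_cases h0 : ν.real Set.univ = 0
      · have : ν = 0 := by
          rwa [measureReal_def, ENNReal.toReal_eq_zero_iff, or_iff_left (measure_ne_top _ _),
            Measure.measure_univ_eq_zero] at h0
        simp [this]
      · rw [smul_eq_mul, mul_inv_cancel_left₀ h0]
    have hmw : Integrable (fun y => m - w y) ν := (integrable_const m).sub hw
    have hlin : Integrable (fun y => 2 * (m - a) * (m - w y) - (m - a) ^ 2) ν :=
      (hmw.const_mul _).sub (integrable_const _)
    have h := integral_mono hlin hi fun y => by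
      show 2 * (m - a) * (m - w y) - (m - a) ^ 2 ≤ (m - w y) ^ 2
      nlinarith [sq_nonneg ((m - w y) - (m - a))]
    rw [integral_sub (hmw.const_mul _) (integrable_const _),
      integral_const_mul, integral_sub (integrable_const m) hw, hint] at h
    simp only [integral_const, smul_eq_mul] at h
    nlinarith
  · have : ∫⁻ y, ENNReal.ofReal ((m - w y) ^ 2) ∂ν = ⊤ := by
      by_contra hne
      refine hi ((lintegral_ofReal_ne_top_iff_integrable ?_
        (ae_of_all _ fun y => sq_nonneg _)).1 hne)
      exact (aestronglyMeasurable_const.sub hw.aestronglyMeasurable).pow 2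
    rw [this]
    exact le_top

lemma integrableOn_ball_of_gagDensity {N : ℕ} {α : ℝ} (hα : 0 ≤ α) {u : EN N → ℝ}
    (hu : Measurable u) {z : EN N} (hz : gagDensity α u z ≠ ⊤) (x : EN N) (r : ℝ) :
    IntegrableOn u (Metric.ball x r) := by
  have : IsFiniteMeasure (volume.restrict (Metric.ball x r)) :=
    ⟨by rw [Measure.restrict_apply_univ]; exact measure_ball_lt_top⟩
  have hne : ∫⁻ y in Metric.ball x r, ENNReal.ofReal ((u z - u y) ^ 2) ≠ ⊤ :=
    ne_top_of_le_ne_top (ENNReal.mul_ne_top ENNReal.ofReal_ne_top hz)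
      (setLIntegral_sq_sub_le hα u x z le_rfl)
  have hsq := (lintegral_ofReal_ne_top_iff_integrable
    ((measurable_const.sub hu).pow_const 2).aestronglyMeasurable
    (ae_of_all _ fun y => sq_nonneg _)).1 hne
  have h2 : MemLp (fun y => u z - u y) 2 (volume.restrict (Metric.ball x r)) :=
    (memLp_two_iff_integrable_sq (measurable_const.sub hu).aestronglyMeasurable).2 hsq
  have h1 := (integrable_const (u z)).sub (h2.integrable (by norm_num))
  refine h1.congr (ae_of_all _ fun y => ?_)
  simp

lemma ofReal_sq_sub_ballMean_mul_le {N : ℕ} {α : ℝ} (hα : 0 ≤ α) {u : EN N → ℝ}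
    (hloc : ∀ x r, IntegrableOn u (Metric.ball x r)) (x z : EN N) {r R : ℝ} (hr : 0 < r)
    (h : ‖z - x‖ + r ≤ R) :
    ENNReal.ofReal ((u z - ballMean u x r) ^ 2) * ENNReal.ofReal (r ^ N * unitVol N) ≤
      ENNReal.ofReal (R ^ ((N : ℝ) + 2 * α)) * gagDensity α u z := by
  have : IsFiniteMeasure (volume.restrict (Metric.ball x r)) :=
    ⟨by rw [Measure.restrict_apply_univ]; exact measure_ball_lt_top⟩
  have h1 := ofReal_sq_sub_average_mul_le _ (hloc x r) (u z)
  rw [Measure.restrict_apply_univ, volume_ball_eq x hr] at h1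
  exact h1.trans (setLIntegral_sq_sub_le hα u x z h)

/-- Comparison of the mean over a ball with the value at its center. -/
lemma sq_sub_ballMean_le {N : ℕ} {α : ℝ} (hα : 0 ≤ α) {u : EN N → ℝ}
    (hloc : ∀ x r, IntegrableOn u (Metric.ball x r)) {x : EN N} (hx : gagDensity α u x ≠ ⊤)
    {r : ℝ} (hr : 0 < r) :
    (u x - ballMean u x r) ^ 2 * (r ^ N * unitVol N) ≤
      r ^ ((N : ℝ) + 2 * α) * (gagDensity α u x).toReal := by
  have h := ofReal_sq_sub_ballMean_mul_le hα hloc x x hr (R := r) (by simp)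
  rw [← ENNReal.ofReal_mul (sq_nonneg _), ← ENNReal.ofReal_toReal hx,
    ← ENNReal.ofReal_mul (by positivity)] at h
  exact (ENNReal.ofReal_le_ofReal_iff (by positivity)).1 h

/-- Comparison of the means over two balls. -/
lemma sq_ballMean_sub_ballMean_le {N : ℕ} {α : ℝ} (hα : 0 ≤ α) {u : EN N → ℝ}
    (hu : Measurable u) (hG : gagSq N α u ≠ ⊤)
    (hloc : ∀ x r, IntegrableOn u (Metric.ball x r)) (x y : EN N) {r s R : ℝ} (hr : 0 < r)
    (hs : 0 < s) (h : ‖x - y‖ + r + s ≤ R) :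
    (ballMean u y s - ballMean u x r) ^ 2 * ((r ^ N * unitVol N) * (s ^ N * unitVol N)) ≤
      R ^ ((N : ℝ) + 2 * α) * (gagSq N α u).toReal := by
  have : IsFiniteMeasure (volume.restrict (Metric.ball x r)) :=
    ⟨by rw [Measure.restrict_apply_univ]; exact measure_ball_lt_top⟩
  have hR : 0 ≤ R := by linarith [norm_nonneg (x - y)]
  have hω := unitVol_pos N
  have h1 := ofReal_sq_sub_average_mul_le _ (hloc x r) (ballMean u y s)
  rw [Measure.restrict_apply_univ, volume_ball_eq x hr] at h1
  have h2 : (∫⁻ z in Metric.ball x r, ENNReal.ofReal ((ballMean u y s - u z) ^ 2)) *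
      ENNReal.ofReal (s ^ N * unitVol N) ≤
      ENNReal.ofReal (R ^ ((N : ℝ) + 2 * α)) * gagSq N α u := by
    rw [← lintegral_gagDensity α hu, ← lintegral_const_mul' _ _ ENNReal.ofReal_ne_top,
      ← lintegral_mul_const' _ _ ENNReal.ofReal_ne_top]
    refine le_trans ?_ (setLIntegral_le_lintegral (Metric.ball x r) _)
    refine setLIntegral_mono' measurableSet_ball fun z hz => ?_
    rw [Metric.mem_ball, dist_eq_norm] at hz
    have hzy : ‖z - y‖ + s ≤ R := by
      have : z - y = (z - x) + (x - y) := by abel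
      rw [this]
      linarith [norm_add_le (z - x) (x - y)]
    rw [show (ballMean u y s - u z) ^ 2 = (u z - ballMean u y s) ^ 2 by ring]
    exact ofReal_sq_sub_ballMean_mul_le hα hloc y z hs hzy
  have h3 := (mul_le_mul_left h1 (ENNReal.ofReal (s ^ N * unitVol N))).trans h2
  rw [← ENNReal.ofReal_mul (sq_nonneg _), ← ENNReal.ofReal_mul (by positivity),
    ← ENNReal.ofReal_toReal hG, ← ENNReal.ofReal_mul (by positivity)] at h3
  rw [← mul_assoc]
  exact (ENNReal.ofReal_le_ofReal_iff (by positivity)).1 h3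

lemma abs_ballMean_sub_ballMean_le {N : ℕ} {α : ℝ} (hα : 0 ≤ α) {u : EN N → ℝ}
    (hu : Measurable u) (hG : gagSq N α u ≠ ⊤)
    (hloc : ∀ x r, IntegrableOn u (Metric.ball x r)) (x y : EN N) {d r s ρ : ℝ} (hr : 0 < r)
    (hs : 0 < s) (hρ : 0 < ρ) (hd : ‖x - y‖ ≤ d * ρ) :
    |ballMean u y (s * ρ) - ballMean u x (r * ρ)| ≤
      √((d + r + s) ^ ((N : ℝ) + 2 * α) * (gagSq N α u).toReal / (r ^ N * s ^ N)) / unitVol N *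
        ρ ^ (-((N - 2 * α) / 2)) := by
  have hω := unitVol_pos N
  have hd0 : 0 ≤ d := nonneg_of_mul_nonneg_left ((norm_nonneg _).trans hd) hρ
  have h := sq_ballMean_sub_ballMean_le hα hu hG hloc x y (r := r * ρ) (s := s * ρ)
    (R := (d + r + s) * ρ) (by positivity) (by positivity) (by linarith)
  apply abs_le_of_sq_le_sq _ (by positivity)
  have hsq : (ρ ^ (-((N - 2 * α) / 2))) ^ 2 = ρ ^ ((N : ℝ) + 2 * α) / (ρ ^ N * ρ ^ N) := by
    rw [← Real.rpow_natCast, ← Real.rpow_mul hρ.le, ← pow_add, ← Real.rpow_natCast ρ (N + N),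
      ← Real.rpow_sub hρ]
    congr 1
    push_cast
    ring
  rw [mul_pow, hsq, div_pow, Real.sq_sqrt (by positivity), div_div, div_mul_div_comm,
    le_div_iff₀ (by positivity)]
  rw [Real.mul_rpow (by positivity) hρ.le, mul_pow, mul_pow] at h
  linarith

/-- The means over large balls converge, with a rate, to a constant not depending on the center. -/
lemma exists_abs_ballMean_sub_le {N : ℕ} {α : ℝ} (hα : 0 ≤ α) (hN : 2 * α < N) {u : EN N → ℝ}
    (hu : Measurable u) (hG : gagSq N α u ≠ ⊤)
    (hloc : ∀ x r, IntegrableOn u (Metric.ball x r)) :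
    ∃ c C : ℝ, 0 ≤ C ∧ ∀ (x : EN N) (r : ℝ), 0 < r →
      |ballMean u x r - c| ≤ C * r ^ (-((N - 2 * α) / 2)) := by
  set β : ℝ := (N - 2 * α) / 2 with hβ
  have hβ0 : 0 < β := by rw [hβ]; linarith
  have hω := unitVol_pos N
  set q : ℝ := 2 ^ (-β) with hq
  have hq0 : 0 < q := by positivity
  have hq1 : q < 1 := Real.rpow_lt_one_of_one_lt_of_neg one_lt_two (by linarith)
  have hpow : ∀ k : ℕ, ((2 : ℝ) ^ k) ^ (-β) = q ^ k := fun k => by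
    rw [hq, ← Real.rpow_natCast, ← Real.rpow_natCast, ← Real.rpow_mul zero_le_two,
      ← Real.rpow_mul zero_le_two, mul_comm]
  set M : ℝ := √(((0 : ℝ) + 1 + 2) ^ ((N : ℝ) + 2 * α) * (gagSq N α u).toReal /
    ((1 : ℝ) ^ N * 2 ^ N)) / unitVol N with hM
  have hM0 : 0 ≤ M := by positivity
  have hstep : ∀ (x : EN N) (r : ℝ), 0 < r → ∀ k : ℕ,
      dist (ballMean u x (r * 2 ^ k)) (ballMean u x (r * 2 ^ (k + 1))) ≤
        M * r ^ (-β) * q ^ k := fun x r hr k => by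
    have h := abs_ballMean_sub_ballMean_le hα hu hG hloc x x (d := 0) (r := 1) (s := 2)
      (ρ := r * 2 ^ k) one_pos two_pos (by positivity) (by simp)
    rw [← hM, ← hβ, Real.mul_rpow hr.le (by positivity), hpow, ← mul_assoc M, one_mul,
      show 2 * (r * 2 ^ k) = r * 2 ^ (k + 1) by ring] at h
    rwa [dist_comm, Real.dist_eq]
  obtain ⟨c, hc⟩ := cauchySeq_tendsto_of_complete
    (cauchySeq_of_le_geometric q _ hq1 (hstep 0 1 one_pos))
  have hq_tendsto : Tendsto (fun k : ℕ => q ^ k) atTop (nhds 0) :=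
    tendsto_pow_atTop_nhds_zero_of_lt_one hq0.le hq1
  have hlim : ∀ (x : EN N) (r : ℝ), 0 < r →
      Tendsto (fun k : ℕ => ballMean u x (r * 2 ^ k)) atTop (nhds c) := fun x r hr => by
    have hdiff : Tendsto (fun k : ℕ => ballMean u x (r * 2 ^ k) - ballMean u 0 (1 * 2 ^ k))
        atTop (nhds 0) := by
      set A : ℝ := √((‖x‖ + 1 + r) ^ ((N : ℝ) + 2 * α) * (gagSq N α u).toReal /
        ((1 : ℝ) ^ N * r ^ N)) / unitVol N with hA
      have hAq : Tendsto (fun k : ℕ => A * q ^ k) atTop (nhds 0) := by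
        simpa using hq_tendsto.const_mul A
      refine squeeze_zero_norm (fun k => ?_) hAq
      have hk : (1 : ℝ) ≤ 2 ^ k := one_le_pow₀ one_le_two
      have h := abs_ballMean_sub_ballMean_le hα hu hG hloc 0 x (d := ‖x‖) (r := 1) (s := r)
        (ρ := 2 ^ k) one_pos hr (by positivity)
        (by rw [zero_sub, norm_neg]; exact le_mul_of_one_le_right (norm_nonneg _) hk)
      rwa [← hβ, hpow, ← hA] at h
    simpa using hdiff.add hc
  refine ⟨c, M / (1 - q), div_nonneg hM0 (by linarith), fun x r hr => ?_⟩
  have h := dist_le_of_le_geometric_of_tendsto₀ q _ hq1 (hstep x r hr) (hlim x r hr)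
  rw [pow_zero, mul_one, Real.dist_eq] at h
  rwa [div_mul_eq_mul_div]

/-- Pointwise form of the fractional Sobolev inequality. -/
lemma exists_abs_sub_rpow_le {N : ℕ} {α : ℝ} (hα : 0 < α) (hN : 2 * α < N) {u : EN N → ℝ}
    (hu : Measurable u) (hG : gagSq N α u ≠ ⊤) :
    ∃ c C : ℝ, 0 ≤ C ∧ ∀ x, gagDensity α u x ≠ ⊤ →
      |u x - c| ^ critExp N α ≤ C * (gagDensity α u x).toReal := by
  have hfin : ∀ᵐ x, gagDensity α u x < ⊤ :=
    ae_lt_top (measurable_gagDensity α hu) (by rwa [lintegral_gagDensity α hu])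
  obtain ⟨z, hz⟩ := hfin.exists
  have hloc : ∀ x r, IntegrableOn u (Metric.ball x r) :=
    integrableOn_ball_of_gagDensity hα.le hu hz.ne
  obtain ⟨c, C, hC, hmean⟩ := exists_abs_ballMean_sub_le hα.le hN hu hG hloc
  have hω := unitVol_pos N
  set β : ℝ := (N - 2 * α) / 2 with hβ
  have hβ0 : 0 < β := by rw [hβ]; linarith
  have hN0 : (0 : ℝ) < N := by linarith
  have hp : critExp N α = N / β := by
    rw [critExp, hβ]
    have : (N : ℝ) - 2 * α ≠ 0 := by linarith
    field_simp
  have hp0 : 0 < critExp N α := by rw [hp]; positivity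
  set E : ℝ := C + 1 / √(unitVol N) with hE
  have hE0 : 0 ≤ E := by positivity
  refine ⟨c, E ^ critExp N α, by positivity, fun x hx => ?_⟩
  set D := (gagDensity α u x).toReal with hD
  have hD0 : 0 ≤ D := ENNReal.toReal_nonneg
  have hbound : ∀ r : ℝ, 0 < r → |u x - c| ≤ C * r ^ (-β) + 1 / √(unitVol N) * (r ^ α * √D) := by
    intro r hr
    have h1 := sq_sub_ballMean_le hα.le hloc hx hr
    have h2 : |u x - ballMean u x r| ≤ 1 / √(unitVol N) * (r ^ α * √D) := by
      apply abs_le_of_sq_le_sq _ (by positivity)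
      rw [mul_pow, mul_pow, Real.sq_sqrt hD0, div_pow, Real.sq_sqrt hω.le, one_pow,
        ← Real.rpow_natCast (r ^ α), ← Real.rpow_mul hr.le, one_div_mul_eq_div,
        le_div_iff₀ hω]
      rw [Real.rpow_add hr, Real.rpow_natCast] at h1
      have hrN : 0 < r ^ N := by positivity
      rw [mul_comm α, Nat.cast_ofNat]
      refine le_of_mul_le_mul_left ?_ hrN
      linarith
    have h3 := abs_sub_le (u x) (ballMean u x r) c
    linarith [hmean x r hr]
  rcases hD0.eq_or_lt with h0 | hpos
  · have hlim : Tendsto (fun r : ℝ => C * r ^ (-β)) atTop (nhds 0) := by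
      simpa using (tendsto_rpow_neg_atTop hβ0).const_mul C
    have hle : |u x - c| ≤ 0 := by
      refine ge_of_tendsto hlim ((eventually_gt_atTop 0).mono fun r hr => ?_)
      have := hbound r hr
      rw [← h0] at this
      simpa using this
    rw [le_antisymm hle (abs_nonneg _), Real.zero_rpow hp0.ne']
    positivity
  · have hrad : 0 < D ^ (-(1 / (N : ℝ))) := by positivity
    have hb := hbound _ hrad
    have e1 : (D ^ (-(1 / (N : ℝ)))) ^ (-β) = D ^ (β / N) := by
      rw [← Real.rpow_mul hD0]
      congr 1
      ring
    have e2 : (D ^ (-(1 / (N : ℝ)))) ^ α * √D = D ^ (β / N) := by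
      rw [← Real.rpow_mul hD0, Real.sqrt_eq_rpow, ← Real.rpow_add hpos]
      congr 1
      rw [hβ]
      field_simp
      ring
    rw [e1, e2, ← add_mul, ← hE] at hb
    calc |u x - c| ^ critExp N α ≤ (E * D ^ (β / N)) ^ critExp N α := by gcongr
      _ = E ^ critExp N α * D := by
        rw [Real.mul_rpow hE0 (by positivity), ← Real.rpow_mul hD0, hp,
          div_mul_div_cancel₀' hβ0.ne', div_self hN0.ne', Real.rpow_one]

/-- Fractional Sobolev embedding modulo constants. -/
lemma exists_integrable_abs_sub_rpow {N : ℕ} {α : ℝ} (hα : 0 < α) (hN : 2 * α < N) {u : EN N → ℝ}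
    (hu : Measurable u) (hG : gagSq N α u ≠ ⊤) :
    ∃ c : ℝ, Integrable (fun x => |u x - c| ^ critExp N α) := by
  obtain ⟨c, C, hC, h⟩ := exists_abs_sub_rpow_le hα hN hu hG
  have hne : ∫⁻ x, gagDensity α u x ≠ ⊤ := by rwa [lintegral_gagDensity α hu]
  have hD := integrable_toReal_of_lintegral_ne_top (measurable_gagDensity α hu).aemeasurable hne
  refine ⟨c, (hD.const_mul C).mono' ?_ ?_⟩
  · exact ((continuous_abs.measurable.comp (hu.sub_const c)).pow_const _).aestronglyMeasurable
  · filter_upwards [ae_lt_top (measurable_gagDensity α hu) hne] with x hx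
    rw [Real.norm_of_nonneg (by positivity)]
    exact h x hx.ne

/-- The quotient `f(ta) a / t`, which is monotone in `t > 0` under (f4). -/
def fiberRatio (f : ℝ → ℝ) (t a : ℝ) : ℝ := f (t * a) * a / t

lemma fiberRatio_zero (f : ℝ → ℝ) (t : ℝ) : fiberRatio f t 0 = 0 := by simp [fiberRatio]

lemma fiberRatio_eq (f : ℝ → ℝ) {t a : ℝ} (ha : a ≠ 0) :
    fiberRatio f t a = a ^ 2 * (f (t * a) / (t * a)) := by
  unfold fiberRatio
  rcases eq_or_ne t 0 with rfl | ht
  · simp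
  · field_simp

lemma div_self_lt_of_Cf4 {f : ℝ → ℝ} (hf4 : Cf4 f) {a s t : ℝ} (ha : a ≠ 0) (hs : 0 < s)
    (hst : s < t) : f (s * a) / (s * a) < f (t * a) / (t * a) := by
  have ht := hs.trans hst
  rcases ha.lt_or_gt with h | h
  · have hsa : s * a < 0 := mul_neg_of_pos_of_neg hs h
    have hta : t * a < 0 := mul_neg_of_pos_of_neg ht h
    have := hf4 (t * a) (s * a) hta.ne hsa.ne (mul_lt_mul_of_neg_right hst h)
    rw [abs_of_neg hsa, abs_of_neg hta, div_neg, div_neg] at this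
    linarith
  · have hsa : 0 < s * a := mul_pos hs h
    have hta : 0 < t * a := mul_pos ht h
    have := hf4 (s * a) (t * a) hsa.ne' hta.ne' (mul_lt_mul_of_pos_right hst h)
    rwa [abs_of_pos hsa, abs_of_pos hta] at this

lemma tendsto_div_self_zero {f : ℝ → ℝ} (hf1 : Cf1 f) :
    Tendsto (fun s => f s / s) (nhdsWithin 0 {(0 : ℝ)}ᶜ) (nhds 0) := by
  refine squeeze_zero_norm (fun s => ?_) (by simpa using hf1.norm)
  simp

lemma tendsto_mul_const_punctured {a : ℝ} (ha : a ≠ 0) :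
    Tendsto (fun t : ℝ => t * a) (nhdsWithin 0 (Set.Ioi 0)) (nhdsWithin 0 {(0 : ℝ)}ᶜ) := by
  refine tendsto_nhdsWithin_iff.2 ⟨?_, ?_⟩
  · have : Tendsto (fun t : ℝ => t * a) (nhds 0) (nhds 0) := by
      simpa using (tendsto_id (α := ℝ) (x := nhds 0)).mul_const a
    exact this.mono_left nhdsWithin_le_nhds
  · filter_upwards [self_mem_nhdsWithin] with t ht
    exact mul_ne_zero (ne_of_gt ht) ha

lemma tendsto_fiberRatio_zero {f : ℝ → ℝ} (hf1 : Cf1 f) (a : ℝ) :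
    Tendsto (fun t => fiberRatio f t a) (nhdsWithin 0 (Set.Ioi 0)) (nhds 0) := by
  rcases eq_or_ne a 0 with rfl | ha
  · simp [fiberRatio_zero]
  · simp_rw [fiberRatio_eq f ha]
    simpa using ((tendsto_div_self_zero hf1).comp (tendsto_mul_const_punctured ha)).const_mul (a ^ 2)

lemma fiberRatio_lt {f : ℝ → ℝ} (hf4 : Cf4 f) {a s t : ℝ} (ha : a ≠ 0) (hs : 0 < s)
    (hst : s < t) : fiberRatio f s a < fiberRatio f t a := by
  rw [fiberRatio_eq f ha, fiberRatio_eq f ha]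
  have := div_self_lt_of_Cf4 hf4 ha hs hst
  gcongr

lemma fiberRatio_mono {f : ℝ → ℝ} (hf4 : Cf4 f) (a : ℝ) {s t : ℝ} (hs : 0 < s) (hst : s ≤ t) :
    fiberRatio f s a ≤ fiberRatio f t a := by
  rcases eq_or_ne a 0 with rfl | ha
  · simp [fiberRatio_zero]
  · rcases hst.eq_or_lt with rfl | h
    · exact le_rfl
    · exact (fiberRatio_lt hf4 ha hs h).le

lemma fiberRatio_nonneg {f : ℝ → ℝ} (hf1 : Cf1 f) (hf4 : Cf4 f) (a : ℝ) {t : ℝ} (ht : 0 < t) :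
    0 ≤ fiberRatio f t a := by
  refine le_of_tendsto (tendsto_fiberRatio_zero hf1 a) ?_
  filter_upwards [Ioo_mem_nhdsGT ht] with s hs
  exact fiberRatio_mono hf4 a hs.1 hs.2.le

lemma continuousAt_fiberRatio {f : ℝ → ℝ} (hf : Continuous f) (a : ℝ) {t : ℝ} (ht : t ≠ 0) :
    ContinuousAt (fun t => fiberRatio f t a) t := by
  unfold fiberRatio
  exact ((hf.comp (continuous_id.mul continuous_const)).mul continuous_const).continuousAt.div
    continuousAt_id ht

lemma hasDerivAt_prim_mul {f : ℝ → ℝ} (hf : Continuous f) (a t : ℝ) :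
    HasDerivAt (fun t => prim f (t * a)) (f (t * a) * a) t := by
  have h := (hf.integral_hasStrictDerivAt 0 (t * a)).hasDerivAt
  have h2 : HasDerivAt (fun t : ℝ => t * a) a t := by simpa using (hasDerivAt_id t).mul_const a
  exact h.comp t h2

/-- The primitive lies above its quadratic comparison along each ray. -/
lemma fiberRatio_mul_le_prim_sub {f : ℝ → ℝ} (hf : Continuous f) (hf4 : Cf4 f) (a : ℝ) {s t : ℝ}
    (hs : 0 < s) (ht : 0 ≤ t) :
    fiberRatio f s a * ((t ^ 2 - s ^ 2) / 2) ≤ prim f (t * a) - prim f (s * a) := by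
  set P : ℝ → ℝ := fun t => prim f (t * a) - fiberRatio f s a * (t ^ 2 / 2) with hP
  have hd : ∀ r, HasDerivAt P (f (r * a) * a - fiberRatio f s a * r) r := fun r => by
    have h2 : HasDerivAt (fun r : ℝ => r ^ 2 / 2) r r := by
      simpa using (hasDerivAt_pow 2 r).div_const 2
    exact (hasDerivAt_prim_mul hf a r).sub (h2.const_mul _)
  have hcont : Continuous P :=
    continuous_iff_continuousAt.2 fun r => (hd r).continuousAt
  have hdiff : Differentiable ℝ P := fun r => (hd r).differentiableAt
  have heq : ∀ r, 0 < r → deriv P r = r * (fiberRatio f r a - fiberRatio f s a) := fun r hr => by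
    rw [(hd r).deriv, mul_sub, mul_comm r (fiberRatio f s a)]
    congr 1
    unfold fiberRatio
    field_simp
  have key : P s ≤ P t := by
    rcases le_total t s with h | h
    · have hanti : AntitoneOn P (Set.Icc 0 s) := by
        refine antitoneOn_of_deriv_nonpos (convex_Icc _ _) hcont.continuousOn
          hdiff.differentiableOn fun r hr => ?_
        rw [interior_Icc] at hr
        rw [heq r hr.1]
        exact mul_nonpos_of_nonneg_of_nonpos hr.1.le
          (sub_nonpos.2 (fiberRatio_mono hf4 a hr.1 hr.2.le))
      exact hanti ⟨ht, h⟩ ⟨hs.le, le_rfl⟩ h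
    · have hmono : MonotoneOn P (Set.Ici s) := by
        refine monotoneOn_of_deriv_nonneg (convex_Ici _) hcont.continuousOn
          hdiff.differentiableOn fun r hr => ?_
        rw [interior_Ici] at hr
        have hr0 : 0 < r := hs.trans hr
        rw [heq r hr0]
        exact mul_nonneg hr0.le (sub_nonneg.2 (fiberRatio_mono hf4 a hs (le_of_lt hr)))
      exact hmono Set.self_mem_Ici h h
  simp only [hP] at key
  linarith

lemma prim_zero (f : ℝ → ℝ) : prim f 0 = 0 := by simp [prim]

lemma continuous_prim {f : ℝ → ℝ} (hf : Continuous f) : Continuous (prim f) :=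
  continuous_iff_continuousAt.2 fun t =>
    (hf.integral_hasStrictDerivAt 0 t).hasDerivAt.continuousAt

lemma prim_nonneg {f : ℝ → ℝ} (hf : Continuous f) (hf1 : Cf1 f) (hf4 : Cf4 f) (a : ℝ) :
    0 ≤ prim f a := by
  have hlim : Tendsto (fun s : ℝ => prim f (s * a)) (nhdsWithin 0 (Set.Ioi 0)) (nhds 0) := by
    have h : Continuous fun s : ℝ => prim f (s * a) :=
      (continuous_prim hf).comp (continuous_id.mul continuous_const)
    have h0 := h.tendsto 0
    rw [zero_mul, prim_zero] at h0
    exact h0.mono_left nhdsWithin_le_nhds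
  refine le_of_tendsto hlim ?_
  filter_upwards [Ioo_mem_nhdsGT one_pos] with s hs
  have h := fiberRatio_mul_le_prim_sub hf hf4 a hs.1 zero_le_one
  have h2 : 0 ≤ fiberRatio f s a * ((1 ^ 2 - s ^ 2) / 2) :=
    mul_nonneg (fiberRatio_nonneg hf1 hf4 a hs.1) (by nlinarith [hs.1, hs.2])
  rw [one_mul] at h
  linarith

lemma prim_mul_le {f : ℝ → ℝ} (hf : Continuous f) (hf4 : Cf4 f) (a : ℝ) {t : ℝ} (ht : 0 < t) :
    prim f (t * a) ≤ fiberRatio f t a * (t ^ 2 / 2) := by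
  have h := fiberRatio_mul_le_prim_sub hf hf4 a ht le_rfl
  rw [zero_mul, prim_zero] at h
  linarith

lemma tendsto_fiberRatio_atTop {f : ℝ → ℝ} (hf : Continuous f) (hf3 : Cf3 f) (hf4 : Cf4 f) {a : ℝ}
    (ha : a ≠ 0) : Tendsto (fun t => fiberRatio f t a) atTop atTop := by
  have h1 : Tendsto (fun t : ℝ => t * a) atTop (comap (fun t : ℝ => |t|) atTop) := by
    rw [tendsto_comap_iff]
    refine tendsto_atTop_mono' _ ?_ (tendsto_id.atTop_mul_const (abs_pos.2 ha))
    filter_upwards [eventually_ge_atTop 0] with t ht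
    simp [abs_mul, abs_of_nonneg ht]
  have h2 := (hf3.comp h1).const_mul_atTop (r := 2 * a ^ 2) (by positivity)
  refine tendsto_atTop_mono' _ ?_ h2
  filter_upwards [eventually_gt_atTop 0] with t ht
  have h := prim_mul_le hf hf4 a ht
  simp only [Function.comp_apply]
  rw [mul_div_assoc', div_le_iff₀ (by positivity)]
  nlinarith [sq_nonneg a, mul_le_mul_of_nonneg_left h (by positivity : 0 ≤ 2 * a ^ 2)]

/-- Growth of a nonlinearity satisfying (f2) and (f4). -/
lemma exists_abs_mul_self_le {f : ℝ → ℝ} {p : ℝ} (hp : 0 < p) (hf2 : Cf2 f p) (hf4 : Cf4 f)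
    (c : ℝ) : ∃ A B : ℝ, 0 ≤ A ∧ 0 ≤ B ∧ ∀ s, |f s * s| ≤ A * s ^ 2 + B * |s - c| ^ p := by
  have hev : ∀ᶠ s in comap (fun t : ℝ => |t|) atTop, |f s / |s| ^ (p - 1)| < 1 := by
    have h := hf2.abs
    rw [abs_zero] at h
    exact h.eventually_lt_const one_pos
  rw [eventually_comap] at hev
  obtain ⟨M₀, hM₀⟩ := eventually_atTop.1 hev
  set M := max M₀ (2 * |c| + 1) with hM
  have hM1 : 2 * |c| + 1 ≤ M := le_max_right _ _
  have hMpos : 0 < M := by linarith [abs_nonneg c]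
  refine ⟨max |f M / M| |f (-M) / M|, 2 ^ p, by positivity, by positivity, fun s => ?_⟩
  rcases eq_or_ne s 0 with rfl | hs
  · simp only [mul_zero, abs_zero]
    positivity
  have hs0 : 0 < |s| := abs_pos.2 hs
  rcases le_or_gt M |s| with h | h
  · have h1 := (hM₀ |s| ((le_max_left _ _).trans h) s rfl).le
    rw [abs_div, abs_of_nonneg (Real.rpow_nonneg (abs_nonneg s) _),
      div_le_one (by positivity)] at h1
    have h2 : |s| ≤ 2 * |s - c| := by
      linarith [abs_sub_abs_le_abs_sub s c]
    calc |f s * s| = |f s| * |s| := abs_mul _ _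
      _ ≤ |s| ^ (p - 1) * |s| := by gcongr
      _ = |s| ^ p := by
        rw [← Real.rpow_add_one hs0.ne', sub_add_cancel]
      _ ≤ (2 * |s - c|) ^ p := by gcongr
      _ = 2 ^ p * |s - c| ^ p := Real.mul_rpow zero_le_two (abs_nonneg _)
      _ ≤ _ := le_add_of_nonneg_left (by positivity)
  · rw [abs_lt] at h
    have h1 := hf4 s M hs hMpos.ne' h.2
    have h2 := hf4 (-M) s (neg_ne_zero.2 hMpos.ne') hs h.1
    rw [abs_of_pos hMpos] at h1
    rw [abs_neg, abs_of_pos hMpos] at h2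
    have h3 : abs (f s / |s|) ≤ max |f M / M| |f (-M) / M| := by
      rw [max_comm]
      exact abs_le_max_abs_abs h2.le h1.le
    rw [abs_div, abs_abs, div_le_iff₀ hs0] at h3
    calc |f s * s| = |f s| * |s| := abs_mul _ _
      _ ≤ max |f M / M| |f (-M) / M| * |s| * |s| := by gcongr
      _ = max |f M / M| |f (-M) / M| * s ^ 2 := by rw [mul_assoc, ← sq, sq_abs]
      _ ≤ _ := le_add_of_nonneg_right (by positivity)

lemma integrable_mul_sq {N : ℕ} {α : ℝ} {V K u : EN N → ℝ} (hK : Continuous K) (h1 : H1 V K)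
    (h3 : H3 V K) (hV : Continuous V) (hu : memX α V u) : Integrable fun x => K x * u x ^ 2 := by
  obtain ⟨hVpos, hKpos, -⟩ := h1
  obtain ⟨C, hC⟩ := h3
  have hVint : Integrable fun x => V x * u x ^ 2 := by
    refine (lintegral_ofReal_ne_top_iff_integrable
      (hV.measurable.mul (hu.1.pow_const 2)).aestronglyMeasurable
      (ae_of_all _ fun x => mul_nonneg (hVpos x).le (sq_nonneg _))).1 ?_
    exact ne_top_of_le_ne_top hu.2.ne le_add_self
  refine (hVint.const_mul C).mono'
    (hK.measurable.mul (hu.1.pow_const 2)).aestronglyMeasurable (ae_of_all _ fun x => ?_)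
  rw [Real.norm_of_nonneg (mul_nonneg (hKpos x).le (sq_nonneg _)), ← mul_assoc]
  gcongr
  exact (div_le_iff₀ (hVpos x)).1 (hC x)

/-- The nonlinear term is integrable along every ray of `X`. -/
lemma integrable_fiberRatio {N : ℕ} {α : ℝ} (hα : 0 < α) (hN : 2 * α < N) {V K : EN N → ℝ}
    {f : ℝ → ℝ} (hV : Continuous V) (hK : Continuous K) (hf : Continuous f) (h1 : H1 V K)
    (h3 : H3 V K) (hf2 : Cf2 f (critExp N α)) (hf4 : Cf4 f) {u : EN N → ℝ} (hu : memX α V u)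
    {t : ℝ} (ht : 0 < t) : Integrable fun x => K x * fiberRatio f t (u x) := by
  have hKsq := integrable_mul_sq hK h1 h3 hV hu
  obtain ⟨-, hKpos, C, hC⟩ := h1
  have hp : 0 < critExp N α := div_pos (by linarith) (by linarith)
  obtain ⟨c, hc⟩ := exists_integrable_abs_sub_rpow hα hN hu.1
    (ne_top_of_le_ne_top hu.2.ne le_self_add)
  obtain ⟨A, B, hA, hB, hgrowth⟩ := exists_abs_mul_self_le hp hf2 hf4 (t * c)
  have hmeas : Measurable fun x => K x * fiberRatio f t (u x) := by
    unfold fiberRatio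
    exact hK.measurable.mul
      (((hf.measurable.comp (hu.1.const_mul t)).mul hu.1).div_const t)
  refine ((hKsq.const_mul A).add
    (hc.const_mul (C * (B * t ^ critExp N α / t ^ 2)))).mono' hmeas.aestronglyMeasurable
    (ae_of_all _ fun x => ?_)
  have hb : |fiberRatio f t (u x)| ≤
      A * u x ^ 2 + B * t ^ critExp N α / t ^ 2 * |u x - c| ^ critExp N α := by
    have he : fiberRatio f t (u x) = f (t * u x) * (t * u x) / t ^ 2 := by
      unfold fiberRatio
      field_simp
    rw [he, abs_div, abs_of_pos (by positivity : 0 < t ^ 2), div_le_iff₀ (by positivity)]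
    refine (hgrowth (t * u x)).trans (le_of_eq ?_)
    rw [← mul_sub, abs_mul, abs_of_pos ht, Real.mul_rpow ht.le (abs_nonneg _)]
    field_simp
  simp only [Pi.add_apply]
  rw [norm_mul, Real.norm_eq_abs, Real.norm_eq_abs, abs_of_pos (hKpos x)]
  calc K x * |fiberRatio f t (u x)|
      ≤ K x * (A * u x ^ 2 + B * t ^ critExp N α / t ^ 2 * |u x - c| ^ critExp N α) :=
        mul_le_mul_of_nonneg_left hb (hKpos x).le
    _ = A * (K x * u x ^ 2) + K x * (B * t ^ critExp N α / t ^ 2 * |u x - c| ^ critExp N α) := by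
        ring
    _ ≤ A * (K x * u x ^ 2) + C * (B * t ^ critExp N α / t ^ 2 * |u x - c| ^ critExp N α) := by
        have := hC x
        gcongr
    _ = _ := by ring

lemma normSq_const_mul {N : ℕ} (α : ℝ) (V u : EN N → ℝ) (t : ℝ) :
    normSq α V (fun x => t * u x) = ENNReal.ofReal (t ^ 2) * normSq α V u := by
  unfold normSq gagSq
  rw [mul_add, ← lintegral_const_mul' _ _ ENNReal.ofReal_ne_top,
    ← lintegral_const_mul' _ _ ENNReal.ofReal_ne_top]
  simp_rw [← ENNReal.ofReal_mul (sq_nonneg t)]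
  congr 3 <;> ext x <;> congr 1 <;> ring

lemma toReal_normSq_pos {N : ℕ} {α : ℝ} {V u : EN N → ℝ} (hV : Continuous V)
    (hVpos : ∀ x, 0 < V x) (hu : memX α V u) (hne : NotAEZero u) :
    0 < (normSq α V u).toReal := by
  refine ENNReal.toReal_pos (fun h0 => hne ?_) hu.2.ne
  have h := (add_eq_zero.1 h0).2
  have hmeas : Measurable fun x => V x * u x ^ 2 := hV.measurable.mul (hu.1.pow_const 2)
  rw [lintegral_eq_zero_iff hmeas.ennreal_ofReal] at h
  filter_upwards [h] with x hx
  simp only [Pi.zero_apply, ENNReal.ofReal_eq_zero] at hx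
  by_contra hux
  exact absurd hx (not_le.2 (mul_pos (hVpos x) (sq_pos_of_ne_zero hux)))

section Fiber

variable {N : ℕ} {K u : EN N → ℝ} {f : ℝ → ℝ}

lemma integral_fiberRatio_lt (hKpos : ∀ x, 0 < K x) (hf4 : Cf4 f)
    (hI : ∀ t, 0 < t → Integrable fun x => K x * fiberRatio f t (u x)) (hne : NotAEZero u)
    {s t : ℝ} (hs : 0 < s) (hst : s < t) :
    ∫ x, K x * fiberRatio f s (u x) < ∫ x, K x * fiberRatio f t (u x) := by
  have hsI := hI s hs
  have htI := hI t (hs.trans hst)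
  rw [← sub_pos, ← integral_sub htI hsI]
  refine lt_of_le_of_ne (integral_nonneg fun x => sub_nonneg.2
    (mul_le_mul_of_nonneg_left (fiberRatio_mono hf4 _ hs hst.le) (hKpos x).le)) fun h => hne ?_
  have h0 := (integral_eq_zero_iff_of_nonneg (fun x => sub_nonneg.2
    (mul_le_mul_of_nonneg_left (fiberRatio_mono hf4 _ hs hst.le) (hKpos x).le))
    (htI.sub hsI)).1 h.symm
  filter_upwards [h0] with x hx
  by_contra hux
  exact (mul_lt_mul_of_pos_left (fiberRatio_lt hf4 hux hs hst) (hKpos x)).ne'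
    (sub_eq_zero.1 hx)

lemma norm_mul_fiberRatio_le (hKpos : ∀ x, 0 < K x) (hf1 : Cf1 f) (hf4 : Cf4 f) {s t : ℝ}
    (hs : 0 < s) (hst : s ≤ t) (x : EN N) :
    ‖K x * fiberRatio f s (u x)‖ ≤ K x * fiberRatio f t (u x) := by
  rw [Real.norm_of_nonneg (mul_nonneg (hKpos x).le (fiberRatio_nonneg hf1 hf4 _ hs))]
  exact mul_le_mul_of_nonneg_left (fiberRatio_mono hf4 _ hs hst) (hKpos x).le

lemma continuousOn_integral_fiberRatio (hf : Continuous f) (hKpos : ∀ x, 0 < K x) (hf1 : Cf1 f)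
    (hf4 : Cf4 f) (hI : ∀ t, 0 < t → Integrable fun x => K x * fiberRatio f t (u x)) :
    ContinuousOn (fun t => ∫ x, K x * fiberRatio f t (u x)) (Set.Ioi 0) := by
  intro t ht
  have ht0 : 0 < t := ht
  refine ContinuousAt.continuousWithinAt
    (continuousAt_of_dominated (bound := fun x => K x * fiberRatio f (t + 1) (u x)) ?_ ?_
      (hI _ (by linarith)) (ae_of_all _ fun x => ?_))
  · filter_upwards [Ioi_mem_nhds ht0] with s hs
    exact (hI s hs).aestronglyMeasurable
  · filter_upwards [Ioo_mem_nhds ht0 (lt_add_one t)] with s hs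
    exact ae_of_all _ (norm_mul_fiberRatio_le hKpos hf1 hf4 hs.1 hs.2.le)
  · exact continuousAt_const.mul (continuousAt_fiberRatio hf _ ht0.ne')

lemma tendsto_integral_fiberRatio_zero (hKpos : ∀ x, 0 < K x) (hf1 : Cf1 f) (hf4 : Cf4 f)
    (hI : ∀ t, 0 < t → Integrable fun x => K x * fiberRatio f t (u x)) :
    Tendsto (fun t => ∫ x, K x * fiberRatio f t (u x)) (nhdsWithin 0 (Set.Ioi 0)) (nhds 0) := by
  have h : Tendsto (fun t => ∫ x, K x * fiberRatio f t (u x)) (nhdsWithin 0 (Set.Ioi 0))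
      (nhds (∫ _ : EN N, (0 : ℝ))) := by
    refine tendsto_integral_filter_of_dominated_convergence
      (fun x => K x * fiberRatio f 1 (u x)) ?_ ?_ (hI 1 one_pos) (ae_of_all _ fun x => ?_)
    · filter_upwards [self_mem_nhdsWithin] with s hs
      exact (hI s hs).aestronglyMeasurable
    · filter_upwards [Ioo_mem_nhdsGT one_pos] with s hs
      exact ae_of_all _ (norm_mul_fiberRatio_le hKpos hf1 hf4 hs.1 hs.2.le)
    · simpa using (tendsto_fiberRatio_zero hf1 (u x)).const_mul (K x)
  simpa using h

lemma exists_lt_integral_fiberRatio (hf : Continuous f) (hK : Continuous K) (hu : Measurable u)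
    (hKpos : ∀ x, 0 < K x) (hf1 : Cf1 f) (hf3 : Cf3 f) (hf4 : Cf4 f)
    (hI : ∀ t, 0 < t → Integrable fun x => K x * fiberRatio f t (u x)) (hne : NotAEZero u)
    (L : ℝ) : ∃ t, 0 < t ∧ L < ∫ x, K x * fiberRatio f t (u x) := by
  by_contra! hL
  have hpos : ∀ n : ℕ, (0 : ℝ) < n + 1 := fun n => by positivity
  have hmeas : ∀ n : ℕ, Measurable fun x =>
      ENNReal.ofReal (K x * fiberRatio f (n + 1) (u x)) := fun n => by
    unfold fiberRatio
    exact (hK.measurable.mul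
      (((hf.measurable.comp (hu.const_mul _)).mul hu).div_const _)).ennreal_ofReal
  have hint : ∀ n : ℕ, ∫⁻ x, ENNReal.ofReal (K x * fiberRatio f (n + 1) (u x)) ≤
      ENNReal.ofReal L := fun n => by
    rw [← ofReal_integral_eq_lintegral_ofReal (hI _ (hpos n)) (ae_of_all _ fun x =>
      mul_nonneg (hKpos x).le (fiberRatio_nonneg hf1 hf4 _ (hpos n)))]
    exact ENNReal.ofReal_le_ofReal (hL _ (hpos n))
  have hliminf : liminf (fun n : ℕ =>
      ∫⁻ x, ENNReal.ofReal (K x * fiberRatio f (n + 1) (u x))) atTop ≤ ENNReal.ofReal L := by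
    refine liminf_le_of_le (by isBoundedDefault) fun b hb => ?_
    obtain ⟨n, hn⟩ := hb.exists
    exact hn.trans (hint n)
  have hfatou := (lintegral_liminf_le (μ := volume) hmeas).trans hliminf
  have hfin := ae_lt_top (Measurable.liminf hmeas)
    (ne_top_of_le_ne_top ENNReal.ofReal_ne_top hfatou)
  refine hne ?_
  filter_upwards [hfin] with x hx
  by_contra hux
  have hto : Tendsto (fun n : ℕ => ENNReal.ofReal (K x * fiberRatio f (n + 1) (u x))) atTop
      (nhds ⊤) := by
    refine ENNReal.tendsto_ofReal_nhds_top.2 (Tendsto.const_mul_atTop (hKpos x) ?_)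
    exact (tendsto_fiberRatio_atTop hf hf3 hf4 hux).comp
      (tendsto_atTop_add_const_right _ _ tendsto_natCast_atTop_atTop)
  exact hx.ne hto.liminf_eq

lemma exists_integral_fiberRatio_eq (hf : Continuous f) (hK : Continuous K) (hu : Measurable u)
    (hKpos : ∀ x, 0 < K x) (hf1 : Cf1 f) (hf3 : Cf3 f) (hf4 : Cf4 f)
    (hI : ∀ t, 0 < t → Integrable fun x => K x * fiberRatio f t (u x)) (hne : NotAEZero u)
    {L : ℝ} (hL : 0 < L) : ∃ t, 0 < t ∧ ∫ x, K x * fiberRatio f t (u x) = L := by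
  obtain ⟨b, hb, hLb⟩ := exists_lt_integral_fiberRatio hf hK hu hKpos hf1 hf3 hf4 hI hne L
  obtain ⟨a, haL, ha⟩ := (((tendsto_integral_fiberRatio_zero hKpos hf1 hf4 hI).eventually_lt_const
    hL).and (Ioo_mem_nhdsGT hb)).exists
  obtain ⟨t, ht, hteq⟩ := intermediate_value_Icc ha.2.le
    ((continuousOn_integral_fiberRatio hf hKpos hf1 hf4 hI).mono fun s hs => ha.1.trans_le hs.1)
    ⟨haL.le, hLb.le⟩
  exact ⟨t, ha.1.trans_le ht.1, hteq⟩

lemma integral_mul_eq_integral_fiberRatio {t : ℝ} (ht : t ≠ 0) :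
    ∫ x, K x * f (t * u x) * u x = t * ∫ x, K x * fiberRatio f t (u x) := by
  rw [← integral_const_mul]
  congr 1 with x
  unfold fiberRatio
  field_simp

lemma integrable_mul_prim (hf : Continuous f) (hK : Continuous K) (hu : Measurable u)
    (hKpos : ∀ x, 0 < K x) (hf1 : Cf1 f) (hf4 : Cf4 f)
    (hI : ∀ t, 0 < t → Integrable fun x => K x * fiberRatio f t (u x)) {t : ℝ} (ht : 0 ≤ t) :
    Integrable fun x => K x * prim f (t * u x) := by
  rcases ht.eq_or_lt with rfl | ht
  · simp [prim_zero]
  refine ((hI t ht).mul_const (t ^ 2 / 2)).mono' ?_ (ae_of_all _ fun x => ?_)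
  · exact (hK.measurable.mul
      ((continuous_prim hf).measurable.comp (hu.const_mul t))).aestronglyMeasurable
  · rw [Real.norm_of_nonneg (mul_nonneg (hKpos x).le (prim_nonneg hf hf1 hf4 _)), mul_assoc]
    exact mul_le_mul_of_nonneg_left (prim_mul_le hf hf4 _ ht) (hKpos x).le

lemma integral_fiberRatio_mul_le (hf : Continuous f) (hK : Continuous K) (hu : Measurable u)
    (hKpos : ∀ x, 0 < K x) (hf1 : Cf1 f) (hf4 : Cf4 f)
    (hI : ∀ t, 0 < t → Integrable fun x => K x * fiberRatio f t (u x)) {s t : ℝ} (hs : 0 < s)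
    (ht : 0 ≤ t) :
    (∫ x, K x * fiberRatio f s (u x)) * ((t ^ 2 - s ^ 2) / 2) ≤
      (∫ x, K x * prim f (t * u x)) - ∫ x, K x * prim f (s * u x) := by
  have hPt := integrable_mul_prim hf hK hu hKpos hf1 hf4 hI ht
  have hPs := integrable_mul_prim hf hK hu hKpos hf1 hf4 hI hs.le
  rw [← integral_sub hPt hPs, ← integral_mul_const]
  refine integral_mono ((hI s hs).mul_const _) (hPt.sub hPs) fun x => ?_
  beta_reduce
  rw [mul_assoc, ← mul_sub]
  exact mul_le_mul_of_nonneg_left (fiberRatio_mul_le_prim_sub hf hf4 _ hs ht) (hKpos x).le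

end Fiber

end ZeroMass

/-- Lemma 3.1(a): for each nonzero `u ∈ X` there is a unique `t_u > 0` with
`t_u u` on the Nehari manifold; the fibering derivative `g` is positive before `t_u`,
vanishes at `t_u`, is negative after, and `J(t_u u)` is the maximum of `t ↦ J(tu)`. -/
theorem statement12 {N : ℕ} (α : ℝ) (hα : α ∈ Set.Ioo (0 : ℝ) 1) (hN : 2 * α < N)
    (V K : EN N → ℝ) (f : ℝ → ℝ)
    (hV : Continuous V) (hK : Continuous K) (hf : Continuous f)
    (h1 : H1 V K) (h2 : H2 K) (h3 : H3 V K)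
    (hf1 : Cf1 f) (hf2 : Cf2 f (critExp N α)) (hf3 : Cf3 f) (hf4 : Cf4 f)
    (u : EN N → ℝ) (hu : memX α V u) (hne : NotAEZero u) :
    ∃ tu : ℝ, 0 < tu ∧
      memNehari2 α V K f (fun x => tu * u x) ∧
      (∀ t : ℝ, 0 < t → memNehari2 α V K f (fun x => t * u x) → t = tu) ∧
      (∀ t : ℝ, 0 < t → t < tu →
        0 < t * (normSq α V u).toReal - ∫ x, K x * f (t * u x) * u x) ∧
      (tu * (normSq α V u).toReal - ∫ x, K x * f (tu * u x) * u x = 0) ∧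
      (∀ t : ℝ, tu < t →
        t * (normSq α V u).toReal - ∫ x, K x * f (t * u x) * u x < 0) ∧
      (∀ t : ℝ, 0 ≤ t →
        Jfun α V K f (fun x => t * u x) ≤ Jfun α V K f (fun x => tu * u x)) := by
  have hKpos := h1.2.1
  have hI : ∀ t, 0 < t → Integrable fun x => K x * fiberRatio f t (u x) := fun t ht =>
    integrable_fiberRatio hα.1 hN hV hK hf h1 h3 hf2 hf4 hu ht
  have hL := toReal_normSq_pos hV h1.1 hu hne
  obtain ⟨τ, hτ, heq⟩ :=
    exists_integral_fiberRatio_eq hf hK hu.1 hKpos hf1 hf3 hf4 hI hne hL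
  have hnorm : ∀ t : ℝ, (normSq α V fun x => t * u x).toReal = t ^ 2 * (normSq α V u).toReal :=
    fun t => by
      rw [normSq_const_mul, ENNReal.toReal_mul, ENNReal.toReal_ofReal (sq_nonneg t)]
  have hg : ∀ t : ℝ, 0 < t → t * (normSq α V u).toReal - ∫ x, K x * f (t * u x) * u x =
      t * ((∫ x, K x * fiberRatio f τ (u x)) - ∫ x, K x * fiberRatio f t (u x)) := fun t ht => by
    rw [integral_mul_eq_integral_fiberRatio ht.ne', heq, mul_sub]
  have hneg : ∀ t, τ < t → t * (normSq α V u).toReal - ∫ x, K x * f (t * u x) * u x < 0 :=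
    fun t ht => by
      rw [hg t (hτ.trans ht)]
      exact mul_neg_of_pos_of_neg (hτ.trans ht)
        (sub_neg.2 (integral_fiberRatio_lt hKpos hf4 hI hne hτ ht))
  have hpos : ∀ t, 0 < t → t < τ →
      0 < t * (normSq α V u).toReal - ∫ x, K x * f (t * u x) * u x := fun t ht htτ => by
    rw [hg t ht]
    exact mul_pos ht (sub_pos.2 (integral_fiberRatio_lt hKpos hf4 hI hne ht htτ))
  have hzero : τ * (normSq α V u).toReal - ∫ x, K x * f (τ * u x) * u x = 0 := by
    rw [hg τ hτ, sub_self, mul_zero]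
  have hint : ∀ t : ℝ, ∫ x, K x * f (t * u x) * (t * u x) =
      t * ∫ x, K x * f (t * u x) * u x := fun t => by
    rw [← integral_const_mul]
    congr 1 with x
    ring
  refine ⟨τ, hτ, ⟨⟨hu.1.const_mul τ, ?_⟩, fun h => hne ?_, ?_⟩, fun t ht hmem => ?_, hpos, hzero,
    hneg, fun t ht => ?_⟩
  · rw [normSq_const_mul]
    exact ENNReal.mul_lt_top ENNReal.ofReal_lt_top hu.2
  · filter_upwards [h] with x hx
    exact (mul_eq_zero.1 hx).resolve_left hτ.ne'
  · rw [hnorm, hint, ← sub_eq_zero.1 hzero]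
    ring
  · have hroot : t * (normSq α V u).toReal - ∫ x, K x * f (t * u x) * u x = 0 := by
      have h := hmem.2.2
      rw [hnorm, hint] at h
      refine mul_left_cancel₀ ht.ne' ?_
      rw [mul_sub, ← h]
      ring
    rcases lt_trichotomy t τ with h | h | h
    · exact absurd hroot (hpos t ht h).ne'
    · exact h
    · exact absurd hroot (hneg t h).ne
  · have h := integral_fiberRatio_mul_le hf hK hu.1 hKpos hf1 hf4 hI hτ ht
    unfold Jfun
    rw [hnorm, hnorm]
    rw [heq] at h
    linarith
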